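/- arXiv:2603.15190 — 2 statements merged into one kernel-verified Lean document; each statement's English description precedes it below -/
import Mathlib

section
/- Sublogarithmic ℓ∞-norm of multinomial vectors: Fix α > 0 and ε > 0. For each integer N, let X^{(N)} be a random vector in S_{⌊αN⌋,N} distributed according to Multinomial(⌊αN⌋, N). Then P[max_i X^{(N)}_i ≥ (1+ε)·(ln N)/(ln ln N)] → 0 as N → ∞. -/
open scoped BigOperators Classical

/-- The discrete simplex `S_{q,N}`: q-tuples of nonnegative integers summing to `N`. -/
def simplex (q N : ℕ) : Finset (Fin q → ℕ) := Finset.Nat.antidiagonalTuple q N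

/-- The `Multinomial(q, N)` probability of observing the occupancy vector `x`:
`(N!/∏ᵢ xᵢ!) q^{-N}` (here `∑ᵢ xᵢ = N` for points of the simplex). -/
noncomputable def multWeight (q N : ℕ) (x : Fin q → ℕ) : ℝ :=
  (Nat.multinomial Finset.univ x : ℝ) / (q : ℝ) ^ N

/-- The probability generating function of one coordinate of a multinomial vector. -/
theorem sum_multWeight_mul_pow (q N : ℕ) (hq : q ≠ 0) (j : Fin q) (s : ℝ) :
    ∑ x ∈ simplex q N, multWeight q N x * s ^ x j = (1 + (s - 1) / q) ^ N := by
  have hq' : (q : ℝ) ≠ 0 := by exact_mod_cast hq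
  have hS : simplex q N = Finset.piAntidiag Finset.univ N := by
    ext x
    simp [simplex, Finset.Nat.mem_antidiagonalTuple]
  have hsum : ∑ i, (Function.update (1 : Fin q → ℝ) j s) i = q + (s - 1) := by
    rw [Finset.sum_update_of_mem (Finset.mem_univ j)]
    have h := Finset.card_sdiff_add_card_eq_card (Finset.subset_univ ({j} : Finset (Fin q)))
    have h' : ((Finset.univ \ {j} : Finset (Fin q)).card : ℝ) + 1 = q := by
      have : (Finset.univ \ {j} : Finset (Fin q)).card + 1 = q := by simpa using h
      exact_mod_cast this
    simp only [Pi.one_apply, Finset.sum_const, nsmul_eq_mul, mul_one]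
    linarith
  have hprod (x : Fin q → ℕ) : ∏ i, (Function.update (1 : Fin q → ℝ) j s) i ^ x i = s ^ x j := by
    rw [Finset.prod_eq_single j] <;> simp +contextual [Function.update_of_ne]
  have key := Finset.sum_pow_eq_sum_piAntidiag Finset.univ (Function.update (1 : Fin q → ℝ) j s) N
  simp only [hprod, hsum, ← hS] at key
  have hbase : 1 + (s - 1) / q = (q + (s - 1)) / q := by field_simp
  rw [hbase, div_pow, key, Finset.sum_div]
  refine Finset.sum_congr rfl fun x _ => ?_
  rw [multWeight]
  ring

theorem multWeight_nonneg (q N : ℕ) (x : Fin q → ℕ) : 0 ≤ multWeight q N x := by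
  unfold multWeight
  positivity

/-- Chernoff's bound, combined with a union bound over the coordinates. -/
theorem sum_multWeight_filter_le (q N : ℕ) (hq : q ≠ 0) (s m : ℝ) (hs : 1 ≤ s) :
    ∑ x ∈ (simplex q N).filter (fun x => ∃ i, m ≤ (x i : ℝ)), multWeight q N x ≤
      q * Real.exp (N * (s - 1) / q) / s ^ m := by
  have hs0 : 0 < s := by linarith
  have hsm : 0 < s ^ m := Real.rpow_pos_of_pos hs0 m
  rw [le_div_iff₀ hsm, Finset.sum_mul]
  calc ∑ x ∈ (simplex q N).filter (fun x => ∃ i, m ≤ (x i : ℝ)), multWeight q N x * s ^ m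
      ≤ ∑ x ∈ (simplex q N).filter (fun x => ∃ i, m ≤ (x i : ℝ)),
          ∑ i, multWeight q N x * s ^ x i := by
        refine Finset.sum_le_sum fun x hx => ?_
        obtain ⟨i, hi⟩ := (Finset.mem_filter.mp hx).2
        have hle : s ^ m ≤ s ^ x i := by
          rw [← Real.rpow_natCast]
          exact Real.rpow_le_rpow_of_exponent_le hs hi
        refine (mul_le_mul_of_nonneg_left hle (multWeight_nonneg q N x)).trans ?_
        exact Finset.single_le_sum (f := fun i => multWeight q N x * s ^ x i)
          (fun i _ => mul_nonneg (multWeight_nonneg q N x) (by positivity)) (Finset.mem_univ i)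
    _ ≤ ∑ x ∈ simplex q N, ∑ i, multWeight q N x * s ^ x i := by
        refine Finset.sum_le_sum_of_subset_of_nonneg (Finset.filter_subset _ _) fun x _ _ => ?_
        exact Finset.sum_nonneg fun i _ => mul_nonneg (multWeight_nonneg q N x) (by positivity)
    _ = q * (1 + (s - 1) / q) ^ N := by
        rw [Finset.sum_comm]
        simp [sum_multWeight_mul_pow q N hq]
    _ ≤ q * Real.exp (N * (s - 1) / q) := by
        have hpos : 0 ≤ (s - 1) / q := div_nonneg (by linarith) (by positivity)
        rw [mul_div_assoc, Real.exp_nat_mul]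
        gcongr
        linarith [Real.add_one_le_exp ((s - 1) / q)]

theorem tendsto_mul_rpow_sub_mul_atBot (c a b : ℝ) (ha : a < 1) (hb : 0 < b) :
    Filter.Tendsto (fun L : ℝ => c * L ^ a - b * L) Filter.atTop Filter.atBot := by
  have h0 : Filter.Tendsto (fun L : ℝ => c * L ^ (-(1 - a)) - b) Filter.atTop (nhds (-b)) := by
    simpa using ((tendsto_rpow_neg_atTop (sub_pos.mpr ha)).const_mul c).sub_const b
  refine (Filter.Tendsto.atTop_mul_neg (neg_lt_zero.mpr hb) Filter.tendsto_id h0).congr' ?_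
  filter_upwards [Filter.eventually_gt_atTop 0] with L hL
  have : L ^ a = L * L ^ (-(1 - a)) := by
    nth_rewrite 2 [← Real.rpow_one L]
    rw [← Real.rpow_add hL]
    ring_nf
  rw [this, id]
  ring

/-- Sublogarithmic ℓ∞-norm of multinomial vectors: the probability, under
`Multinomial(⌊αN⌋, N)`, that some coordinate is at least `(1+ε) ln N / ln ln N`
tends to `0` as `N → ∞`. -/
theorem multinomial_sup_norm_sublog (α ε : ℝ) (hα : 0 < α) (hε : 0 < ε) :
    Filter.Tendsto
      (fun N : ℕ =>
        ∑ x ∈ (simplex ⌊α * (N : ℝ)⌋₊ N).filter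
            (fun x => ∃ i, (1 + ε) * Real.log N / Real.log (Real.log N) ≤ (x i : ℝ)),
          multWeight ⌊α * (N : ℝ)⌋₊ N x)
      Filter.atTop (nhds 0) := by
  set a : ℝ := (1 + ε / 2) / (1 + ε) with ha_def
  have ha0 : 0 ≤ a := by positivity
  have ha1 : a < 1 := by rw [ha_def, div_lt_one (by positivity)]; linarith
  have haε : a * (1 + ε) = 1 + ε / 2 := by rw [ha_def]; field_simp
  have hlog : Filter.Tendsto (fun N : ℕ => Real.log N) Filter.atTop Filter.atTop :=
    Real.tendsto_log_atTop.comp tendsto_natCast_atTop_atTop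
  have hlim : Filter.Tendsto (fun N : ℕ => α * Real.exp
      (2 / α * Real.log N ^ a - ε / 2 * Real.log N)) Filter.atTop (nhds 0) := by
    simpa using (Real.tendsto_exp_atBot.comp ((tendsto_mul_rpow_sub_mul_atBot (2 / α) a (ε / 2)
      ha1 (by positivity)).comp hlog)).const_mul α
  refine tendsto_of_tendsto_of_tendsto_of_le_of_le' tendsto_const_nhds hlim
    (Filter.Eventually.of_forall fun N => Finset.sum_nonneg fun x _ => multWeight_nonneg _ _ x) ?_
  filter_upwards [hlog.eventually_gt_atTop 1, Filter.eventually_gt_atTop 0,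
    tendsto_natCast_atTop_atTop.eventually_ge_atTop (2 / α)] with N hL hN hNα
  set L := Real.log N
  have hN' : (0 : ℝ) < N := by exact_mod_cast hN
  have hαN : 2 ≤ α * N := by rwa [div_le_iff₀' hα] at hNα
  set q := ⌊α * (N : ℝ)⌋₊
  have hq_le : (q : ℝ) ≤ α * N := Nat.floor_le (by positivity)
  have hq_ge : α * N / 2 ≤ q := by linarith [Nat.lt_floor_add_one (α * (N : ℝ))]
  have hq_pos : (0 : ℝ) < q := by linarith
  have hq : q ≠ 0 := by exact_mod_cast hq_pos.ne'
  have hL0 : 0 < L := by linarith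
  have hs : 1 ≤ L ^ a := Real.one_le_rpow hL.le ha0
  have hloglog : 0 < Real.log L := Real.log_pos hL
  refine (sum_multWeight_filter_le q N hq (L ^ a) _ hs).trans ?_
  have hpow : (L ^ a) ^ ((1 + ε) * L / Real.log L) = Real.exp ((1 + ε / 2) * L) := by
    rw [← Real.rpow_mul hL0.le, Real.rpow_def_of_pos hL0, ← haε]
    congr 1
    field_simp
  have hexp : N * (L ^ a - 1) / q ≤ 2 / α * L ^ a := by
    rw [div_le_iff₀ hq_pos]
    calc N * (L ^ a - 1) ≤ N * L ^ a := by gcongr; linarith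
      _ = 2 / α * L ^ a * (α * N / 2) := by field_simp
      _ ≤ 2 / α * L ^ a * q := by gcongr
  rw [hpow]
  calc q * Real.exp (N * (L ^ a - 1) / q) / Real.exp ((1 + ε / 2) * L)
      ≤ α * N * Real.exp (2 / α * L ^ a) / Real.exp ((1 + ε / 2) * L) := by gcongr
    _ = α * Real.exp (2 / α * L ^ a - ε / 2 * L) := by
      rw [← Real.exp_log hN', mul_assoc, mul_div_assoc, ← Real.exp_add, ← Real.exp_sub]
      congr 2
      ring
end

section
/- Typical vectors exhaust the simplex: Fix reals α > 0, ε > 0 and ξ ∈ (0, 1/2). For each integer N ≥ 2, let T_N be the set of x ∈ S_{⌊αN⌋,N} satisfying both | |supp(x)|/N − α/(1+α) | ≤ N^{−1/2+ξ} and max_i x_i ≤ (1+ε)·log_{1+α} N. Then |T_N| / |S_{⌊αN⌋,N}| → 1 as N → ∞. -/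
open scoped BigOperators Classical

/-- The number of nonzero coordinates (support size) of a vector. -/
def suppCard {q : ℕ} (x : Fin q → ℕ) : ℕ := (Finset.univ.filter fun i => x i ≠ 0).card

theorem mem_simplex {q N : ℕ} {x : Fin q → ℕ} : x ∈ simplex q N ↔ ∑ i, x i = N := by
  simp [simplex, Finset.Nat.mem_antidiagonalTuple]

theorem card_simplex_succ (m n : ℕ) : (simplex (m + 1) n).card = (n + m).choose m := by
  have h := Nat.card_congr ((Sym.equivNatSumOfFintype (Fin (m + 1)) n).trans
    (Equiv.subtypeEquivRight fun x => (mem_simplex (x := x)).symm))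
  rw [Nat.card_eq_fintype_card, Sym.card_sym_eq_choose, Nat.card_eq_fintype_card,
    Fintype.card_coe, Fintype.card_fin] at h
  rw [← h, show m + 1 + n - 1 = n + m by omega, Nat.choose_symm_add]

theorem pi_single_le_iff {q k : ℕ} {i : Fin q} {x : Fin q → ℕ} :
    Pi.single i k ≤ x ↔ k ≤ x i := by
  simp [Pi.single, update_le_iff]

/-- Ratio of the cardinalities of consecutive simplices. -/
theorem card_simplex_mul {q n : ℕ} (hq : 1 ≤ q) :
    ((simplex q n).card : ℝ) * (n + q) = (simplex q (n + 1)).card * (n + 1) := by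
  obtain ⟨m, rfl⟩ := Nat.exists_eq_add_of_le' hq
  rw [card_simplex_succ, card_simplex_succ]
  have h := Nat.choose_mul_succ_eq (n + m) m
  rw [show n + m + 1 - m = n + 1 by omega, show n + m + 1 = n + 1 + m by omega] at h
  have h' : (((n + m).choose m * (n + 1 + m) : ℕ) : ℝ) =
      ((n + 1 + m).choose m * (n + 1) : ℕ) := by rw [h]
  push_cast at h' ⊢
  linarith

theorem card_simplex_pos {q : ℕ} (hq : 1 ≤ q) (n : ℕ) : 0 < (simplex q n).card := by
  obtain ⟨m, rfl⟩ := Nat.exists_eq_add_of_le' hq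
  rw [card_simplex_succ]
  exact Nat.choose_pos (by omega)

/-- The points of a simplex dominating `v` are the translates by `v` of a smaller simplex. -/
theorem card_filter_le_simplex {q n k : ℕ} {v : Fin q → ℕ} (hv : ∑ i, v i = k) :
    ((simplex q (n + k)).filter fun x => v ≤ x).card = (simplex q n).card := by
  symm
  refine Finset.card_bij (fun x _ => x + v) ?_ ?_ ?_
  · intro x hx
    rw [mem_simplex] at hx
    simp [mem_simplex, Finset.sum_add_distrib, hx, hv]
  · intro x _ y _ h
    exact add_right_cancel h
  · intro x hx
    simp only [Finset.mem_filter, mem_simplex] at hx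
    refine ⟨x - v, ?_, tsub_add_cancel_of_le hx.2⟩
    rw [mem_simplex]
    have h : ∑ i, (x - v) i + ∑ i, v i = ∑ i, x i := by
      rw [← Finset.sum_add_distrib]
      exact Finset.sum_congr rfl fun i _ => Nat.sub_add_cancel (hx.2 i)
    omega

/-- The proportion `N / (N + q - 1)` of points of `simplex q N` with a given coordinate nonzero. -/
noncomputable def nonzeroProb (q N : ℕ) : ℝ := N / (N + q - 1)

theorem nonzeroProb_pos {q N : ℕ} (hq : 1 ≤ q) (hN : 1 ≤ N) : 0 < nonzeroProb q N := by
  have h1 : (1 : ℝ) ≤ q := by exact_mod_cast hq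
  have h2 : (1 : ℝ) ≤ N := by exact_mod_cast hN
  exact div_pos (by linarith) (by linarith)

theorem nonzeroProb_le_one {q N : ℕ} (hq : 1 ≤ q) : nonzeroProb q N ≤ 1 := by
  have h1 : (1 : ℝ) ≤ q := by exact_mod_cast hq
  exact div_le_one_of_le₀ (by linarith) (by linarith [(N.cast_nonneg : (0 : ℝ) ≤ N)])

theorem nonzeroProb_mono {q : ℕ} (hq : 1 ≤ q) {m n : ℕ} (hm : 1 ≤ m) (hmn : m ≤ n) :
    nonzeroProb q m ≤ nonzeroProb q n := by
  have h1 : (1 : ℝ) ≤ q := by exact_mod_cast hq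
  have h2 : (1 : ℝ) ≤ m := by exact_mod_cast hm
  have h3 : (m : ℝ) ≤ n := by exact_mod_cast hmn
  rw [nonzeroProb, nonzeroProb, div_le_div_iff₀ (by linarith) (by linarith)]
  nlinarith

theorem card_simplex_eq_nonzeroProb_mul {q n : ℕ} (hq : 1 ≤ q) :
    ((simplex q n).card : ℝ) = nonzeroProb q (n + 1) * (simplex q (n + 1)).card := by
  have h1 : (1 : ℝ) ≤ q := by exact_mod_cast hq
  have h2 : (0 : ℝ) ≤ n := n.cast_nonneg
  have h := card_simplex_mul (n := n) hq
  have h3 : (n : ℝ) + q ≠ 0 := by linarith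
  rw [nonzeroProb]
  push_cast
  rw [show (n : ℝ) + 1 + q - 1 = n + q by ring]
  field_simp
  linarith

theorem card_simplex_le_pow_mul {q : ℕ} (hq : 1 ≤ q) (n k : ℕ) :
    ((simplex q n).card : ℝ) ≤ nonzeroProb q (n + k) ^ k * (simplex q (n + k)).card := by
  induction k with
  | zero => simp
  | succ k ih =>
    refine ih.trans ?_
    rw [card_simplex_eq_nonzeroProb_mul (n := n + k) hq, ← mul_assoc, pow_succ, ← add_assoc]
    have h0 : 0 < nonzeroProb q (n + k + 1) := nonzeroProb_pos hq (by omega)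
    have hmono : nonzeroProb q (n + k) ^ k ≤ nonzeroProb q (n + k + 1) ^ k := by
      rcases Nat.eq_zero_or_pos k with rfl | hk
      · simp
      · have h1 := nonzeroProb_pos hq (by omega : 1 ≤ n + k)
        exact pow_le_pow_left₀ h1.le (nonzeroProb_mono hq (by omega) (Nat.le_succ _)) k
    gcongr

theorem card_filter_coord_ge_le {q : ℕ} (hq : 1 ≤ q) (N k : ℕ) (i : Fin q) :
    (((simplex q N).filter fun x => k ≤ x i).card : ℝ) ≤
      nonzeroProb q N ^ k * (simplex q N).card := by
  rcases le_or_gt k N with h | h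
  · obtain ⟨n, rfl⟩ := Nat.exists_eq_add_of_le' h
    refine le_trans (le_of_eq ?_) (card_simplex_le_pow_mul hq n k)
    rw [← card_filter_le_simplex (n := n) (v := Pi.single i k) (k := k) (by simp)]
    simp [pi_single_le_iff]
  · have h0 : ((simplex q N).filter fun x => k ≤ x i) = ∅ := by
      refine Finset.filter_false_of_mem fun x hx hk => ?_
      rw [mem_simplex] at hx
      have := Finset.single_le_sum (f := x) (fun _ _ => Nat.zero_le _) (Finset.mem_univ i)
      omega
    rw [h0]
    rcases Nat.eq_zero_or_pos N with rfl | hN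
    · simp only [nonzeroProb, Finset.card_empty, Nat.cast_zero, zero_div]
      positivity
    · have := nonzeroProb_pos hq hN
      simp only [Finset.card_empty, Nat.cast_zero]
      positivity

theorem card_filter_ne_zero {q N : ℕ} (hq : 1 ≤ q) (hN : 1 ≤ N) (i : Fin q) :
    (((simplex q N).filter fun x => x i ≠ 0).card : ℝ) =
      nonzeroProb q N * (simplex q N).card := by
  obtain ⟨n, rfl⟩ := Nat.exists_eq_add_of_le' hN
  rw [← card_simplex_eq_nonzeroProb_mul hq,
    ← card_filter_le_simplex (n := n) (v := Pi.single i 1) (k := 1) (by simp)]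
  simp [pi_single_le_iff, Nat.one_le_iff_ne_zero]

theorem card_filter_ne_zero_and_le {q N : ℕ} (hq : 1 ≤ q) (hN : 2 ≤ N) {i j : Fin q}
    (hij : i ≠ j) :
    (((simplex q N).filter fun x => x i ≠ 0 ∧ x j ≠ 0).card : ℝ) ≤
      nonzeroProb q N ^ 2 * (simplex q N).card := by
  obtain ⟨n, rfl⟩ := Nat.exists_eq_add_of_le' hN
  refine le_trans (le_of_eq ?_) (card_simplex_le_pow_mul hq n 2)
  rw [← card_filter_le_simplex (n := n) (v := Pi.single i 1 + Pi.single j 1) (k := 2)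
    (by simp [Finset.sum_add_distrib])]
  congr 2
  ext x
  simp only [Finset.mem_filter, and_congr_right_iff]
  intro _
  constructor
  · rintro ⟨h1, h2⟩ l
    by_cases hli : l = i
    · subst hli
      simp [hij]
      omega
    · by_cases hlj : l = j
      · subst hlj
        simp [hli]
        omega
      · simp [hli, hlj]
  · intro h
    have h1 := h i
    have h2 := h j
    simp [hij] at h1
    simp [hij.symm] at h2
    omega

theorem suppCard_eq_sum {q : ℕ} (x : Fin q → ℕ) :
    (suppCard x : ℝ) = ∑ i, if x i ≠ 0 then (1 : ℝ) else 0 := by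
  simp only [suppCard, Finset.sum_boole]

theorem sum_suppCard {q N : ℕ} (hq : 1 ≤ q) (hN : 1 ≤ N) :
    ∑ x ∈ simplex q N, (suppCard x : ℝ) = q * nonzeroProb q N * (simplex q N).card := by
  simp_rw [suppCard_eq_sum]
  rw [Finset.sum_comm]
  simp_rw [Finset.sum_boole, card_filter_ne_zero hq hN]
  simp [mul_assoc]

theorem sum_suppCard_sq_le {q N : ℕ} (hq : 1 ≤ q) (hN : 2 ≤ N) :
    ∑ x ∈ simplex q N, (suppCard x : ℝ) ^ 2 ≤
      (q ^ 2 * nonzeroProb q N ^ 2 + q) * (simplex q N).card := by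
  have hsq (x : Fin q → ℕ) : (suppCard x : ℝ) ^ 2 =
      ∑ i, ∑ j, if x i ≠ 0 ∧ x j ≠ 0 then (1 : ℝ) else 0 := by
    rw [sq, suppCard_eq_sum, Finset.sum_mul_sum]
    refine Finset.sum_congr rfl fun i _ => Finset.sum_congr rfl fun j _ => ?_
    by_cases h1 : x i = 0 <;> by_cases h2 : x j = 0 <;> simp [h1, h2]
  have hpair (i j : Fin q) : (((simplex q N).filter fun x => x i ≠ 0 ∧ x j ≠ 0).card : ℝ) ≤
      nonzeroProb q N ^ 2 * (simplex q N).card +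
        if i = j then ((simplex q N).card : ℝ) else 0 := by
    split_ifs with h
    · have : (((simplex q N).filter fun x => x i ≠ 0 ∧ x j ≠ 0).card : ℝ) ≤
          (simplex q N).card := by exact_mod_cast Finset.card_filter_le _ _
      have : 0 ≤ nonzeroProb q N ^ 2 * (simplex q N).card := by positivity
      linarith
    · simpa using card_filter_ne_zero_and_le hq hN h
  simp_rw [hsq]
  rw [Finset.sum_comm]
  calc ∑ i, ∑ x ∈ simplex q N, ∑ j, (if x i ≠ 0 ∧ x j ≠ 0 then (1 : ℝ) else 0)
      = ∑ i, ∑ j, (((simplex q N).filter fun x => x i ≠ 0 ∧ x j ≠ 0).card : ℝ) := by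
        refine Finset.sum_congr rfl fun i _ => ?_
        rw [Finset.sum_comm]
        simp_rw [Finset.sum_boole]
    _ ≤ ∑ i : Fin q, ∑ j : Fin q, (nonzeroProb q N ^ 2 * (simplex q N).card +
          if i = j then ((simplex q N).card : ℝ) else 0) :=
        Finset.sum_le_sum fun i _ => Finset.sum_le_sum fun j _ => hpair i j
    _ = (q ^ 2 * nonzeroProb q N ^ 2 + q) * (simplex q N).card := by
        simp [Finset.sum_add_distrib]
        ring

theorem sum_suppCard_sub_mean_sq_le {q N : ℕ} (hq : 1 ≤ q) (hN : 2 ≤ N) :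
    ∑ x ∈ simplex q N, ((suppCard x : ℝ) - q * nonzeroProb q N) ^ 2 ≤
      q * (simplex q N).card := by
  have h1 := sum_suppCard hq (by omega : 1 ≤ N)
  have h2 := sum_suppCard_sq_le hq hN
  simp_rw [sub_sq, Finset.sum_add_distrib, Finset.sum_sub_distrib]
  rw [← Finset.sum_mul, ← Finset.mul_sum, h1]
  simp only [Finset.sum_const, nsmul_eq_mul]
  linarith

theorem card_filter_suppCard_deviation_le {q N : ℕ} (hq : 1 ≤ q) (hN : 2 ≤ N) {t : ℝ}
    (ht : 0 < t) :
    (((simplex q N).filter fun x => t < |(suppCard x : ℝ) - q * nonzeroProb q N|).card : ℝ) ≤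
      q / t ^ 2 * (simplex q N).card := by
  rw [div_mul_eq_mul_div, le_div_iff₀ (by positivity)]
  refine le_trans ?_ (sum_suppCard_sub_mean_sq_le hq hN)
  rw [← nsmul_eq_mul]
  refine le_trans (Finset.card_nsmul_le_sum _ _ _ fun x hx => ?_)
    (Finset.sum_le_sum_of_subset_of_nonneg (Finset.filter_subset _ _) fun _ _ _ => sq_nonneg _)
  rw [← sq_abs (_ - _)]
  exact pow_le_pow_left₀ ht.le (Finset.mem_filter.1 hx).2.le 2

/-- Union bound for the two ways in which a point of the simplex can fail to be typical. -/
theorem one_sub_le_card_filter_div {q N k : ℕ} (hq : 1 ≤ q) (hN : 2 ≤ N) {t : ℝ} (ht : 0 < t)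
    {P : (Fin q → ℕ) → Prop} [DecidablePred P]
    (hP : ∀ x, |(suppCard x : ℝ) - q * nonzeroProb q N| ≤ t → (∀ i, x i < k) → P x) :
    1 - (q / t ^ 2 + q * nonzeroProb q N ^ k) ≤
      (((simplex q N).filter P).card : ℝ) / (simplex q N).card := by
  have hc : (0 : ℝ) < (simplex q N).card := by exact_mod_cast card_simplex_pos hq N
  rw [le_div_iff₀ hc]
  have hsub : simplex q N ⊆ (simplex q N).filter P ∪
      (((simplex q N).filter fun x => t < |(suppCard x : ℝ) - q * nonzeroProb q N|) ∪
        Finset.univ.biUnion fun i => (simplex q N).filter fun x => k ≤ x i) := by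
    intro x hx
    simp only [Finset.mem_union, Finset.mem_filter, Finset.mem_biUnion, Finset.mem_univ,
      true_and, hx]
    by_contra! h
    exact h.1 (hP x h.2.1 h.2.2)
  have h1 := (Finset.card_le_card hsub).trans ((Finset.card_union_le _ _).trans
    (Nat.add_le_add_left ((Finset.card_union_le _ _).trans
      (Nat.add_le_add_left Finset.card_biUnion_le _)) _))
  have h2 : ((simplex q N).card : ℝ) ≤ ((simplex q N).filter P).card +
      (((simplex q N).filter fun x => t < |(suppCard x : ℝ) - q * nonzeroProb q N|).card +
        ∑ i, (((simplex q N).filter fun x => k ≤ x i).card : ℝ)) := by exact_mod_cast h1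
  have h3 := card_filter_suppCard_deviation_le hq hN ht
  have h4 : ∑ i, (((simplex q N).filter fun x => k ≤ x i).card : ℝ) ≤
      q * nonzeroProb q N ^ k * (simplex q N).card := by
    refine (Finset.sum_le_sum fun i _ => card_filter_coord_ge_le hq N k i).trans ?_
    simp [mul_assoc]
  linarith

theorem abs_mean_sub_le {α : ℝ} (hα : 0 < α) {q N : ℕ} (hq : 1 ≤ q) (hN : 1 ≤ N)
    (h1 : (q : ℝ) ≤ α * N) (h2 : α * N < q + 1) :
    |q * nonzeroProb q N - N * (α / (1 + α))| ≤ 1 := by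
  have hq' : (1 : ℝ) ≤ q := by exact_mod_cast hq
  have hN' : (1 : ℝ) ≤ N := by exact_mod_cast hN
  have hd : (0 : ℝ) < N + q - 1 := by linarith
  have ha : 0 < 1 + α := by linarith
  have key : q * nonzeroProb q N - N * (α / (1 + α)) =
      N * (q - α * N + α) / ((N + q - 1) * (1 + α)) := by
    rw [nonzeroProb]
    field_simp
    ring
  rw [key, abs_div, abs_of_pos (mul_pos hd ha), div_le_one (mul_pos hd ha), abs_mul,
    abs_of_pos (by linarith : (0 : ℝ) < N)]
  have h3 : |(q : ℝ) - α * N + α| ≤ 1 + α := abs_le.2 ⟨by linarith, by linarith⟩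
  exact mul_le_mul (by linarith) h3 (abs_nonneg _) hd.le

open Filter Topology in
theorem tendsto_nonzeroProb {α : ℝ} (hα : 0 < α) :
    Tendsto (fun N : ℕ => nonzeroProb ⌊α * (N : ℝ)⌋₊ N) atTop (𝓝 (1 / (1 + α))) := by
  have hf : Tendsto (fun N : ℕ => (⌊α * (N : ℝ)⌋₊ : ℝ) / N) atTop (𝓝 α) :=
    (tendsto_nat_floor_mul_div_atTop hα.le).comp tendsto_natCast_atTop_atTop
  have hi : Tendsto (fun N : ℕ => (1 : ℝ) / N) atTop (𝓝 0) := tendsto_one_div_atTop_nhds_zero_nat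
  have h := (tendsto_const_nhds (x := (1 : ℝ))).div ((hf.const_add 1).sub hi)
    (by simp; linarith)
  rw [sub_zero] at h
  refine h.congr' ?_
  filter_upwards [eventually_gt_atTop 0] with N hN
  have hN' : (N : ℝ) ≠ 0 := by positivity
  simp only [Pi.div_apply, nonzeroProb]
  rw [← div_self hN', ← add_div, ← sub_div, div_div_div_cancel_right₀ hN', div_self hN']

open Filter Topology in
/-- Eventually the probability that a coordinate exceeds `(1 + ε) log_{1+α} N` is at most
`N ^ (-(1 + ε / 2))`. -/
theorem eventually_nonzeroProb_pow_le {α ε : ℝ} (hα : 0 < α) (hε : 0 < ε) :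
    ∀ᶠ N : ℕ in atTop, nonzeroProb ⌊α * (N : ℝ)⌋₊ N ^
      (⌊(1 + ε) * Real.logb (1 + α) N⌋₊ + 1) ≤ (N : ℝ) ^ (-(1 + ε / 2)) := by
  have ha : 1 < 1 + α := by linarith
  have hlt : 1 / (1 + α) < (1 + α) ^ (-((1 + ε / 2) / (1 + ε))) := by
    rw [one_div, ← Real.rpow_neg_one]
    apply Real.rpow_lt_rpow_of_exponent_lt ha
    rw [neg_lt_neg_iff, div_lt_one (by linarith)]
    linarith
  filter_upwards [(tendsto_nonzeroProb hα).eventually_lt_const hlt, eventually_ge_atTop 1,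
    (tendsto_nat_floor_atTop.comp
      (tendsto_natCast_atTop_atTop.const_mul_atTop hα)).eventually_ge_atTop 1] with N hp hN hq
  have hN' : (1 : ℝ) ≤ N := by exact_mod_cast hN
  have hp0 : 0 < nonzeroProb ⌊α * (N : ℝ)⌋₊ N := nonzeroProb_pos hq hN
  have hL : 0 ≤ Real.logb (1 + α) N := Real.logb_nonneg ha hN'
  calc nonzeroProb ⌊α * (N : ℝ)⌋₊ N ^ (⌊(1 + ε) * Real.logb (1 + α) N⌋₊ + 1)
      ≤ nonzeroProb ⌊α * (N : ℝ)⌋₊ N ^ ((1 + ε) * Real.logb (1 + α) N) := by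
        rw [← Real.rpow_natCast]
        apply Real.rpow_le_rpow_of_exponent_ge hp0 (nonzeroProb_le_one hq)
        push_cast
        exact (Nat.lt_floor_add_one _).le
    _ ≤ ((1 + α) ^ (-((1 + ε / 2) / (1 + ε)))) ^ ((1 + ε) * Real.logb (1 + α) N) :=
        Real.rpow_le_rpow hp0.le hp.le (by positivity)
    _ = (N : ℝ) ^ (-(1 + ε / 2)) := by
        nth_rewrite 2 [← Real.rpow_logb (by linarith) ha.ne' (by linarith : (0 : ℝ) < N)]
        rw [← Real.rpow_mul (by linarith), ← Real.rpow_mul (by linarith)]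
        congr 1
        field_simp

/-- Typical vectors exhaust the simplex: the fraction of points of `S_{⌊αN⌋,N}` whose
normalized support size is within `N^{-1/2+ξ}` of `α/(1+α)` and whose coordinates are all
at most `(1+ε) log_{1+α} N` tends to `1` as `N → ∞`. -/
theorem typical_vectors_exhaust_simplex (α ε ξ : ℝ)
    (hα : 0 < α) (hε : 0 < ε) (hξ0 : 0 < ξ) (hξ1 : ξ < 1 / 2) :
    Filter.Tendsto
      (fun N : ℕ =>
        (((simplex ⌊α * (N : ℝ)⌋₊ N).filter fun x =>
            |(suppCard x : ℝ) / (N : ℝ) - α / (1 + α)| ≤ (N : ℝ) ^ (-(1 / 2 : ℝ) + ξ) ∧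
              ∀ i, (x i : ℝ) ≤ (1 + ε) * Real.logb (1 + α) (N : ℝ)).card : ℝ) /
          ((simplex ⌊α * (N : ℝ)⌋₊ N).card : ℝ))
      Filter.atTop (nhds 1) := by
  have hlim : Filter.Tendsto
      (fun N : ℕ => 1 - (4 * α * (N : ℝ) ^ (-(2 * ξ)) + α * (N : ℝ) ^ (-(ε / 2))))
      Filter.atTop (nhds 1) := by
    have h1 := (tendsto_rpow_neg_atTop (by linarith : 0 < 2 * ξ)).comp
      (tendsto_natCast_atTop_atTop (R := ℝ))
    have h2 := (tendsto_rpow_neg_atTop (by linarith : 0 < ε / 2)).comp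
      (tendsto_natCast_atTop_atTop (R := ℝ))
    simpa using ((h1.const_mul (4 * α)).add (h2.const_mul α)).const_sub 1
  have hroot : ∀ᶠ N : ℕ in Filter.atTop, (2 : ℝ) ≤ (N : ℝ) ^ (1 / 2 + ξ) :=
    ((tendsto_rpow_atTop (by linarith : 0 < 1 / 2 + ξ)).comp
      tendsto_natCast_atTop_atTop).eventually_ge_atTop 2
  refine tendsto_of_tendsto_of_tendsto_of_le_of_le' hlim tendsto_const_nhds ?_
    (Filter.Eventually.of_forall fun N => div_le_one_of_le₀
      (by exact_mod_cast Finset.card_filter_le _ _) (Nat.cast_nonneg _))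
  filter_upwards [hroot, eventually_nonzeroProb_pow_le hα hε, Filter.eventually_ge_atTop 2,
    (tendsto_nat_floor_atTop.comp
      (tendsto_natCast_atTop_atTop.const_mul_atTop hα)).eventually_ge_atTop 1]
    with N hroot hpow hN hq
  simp only [Function.comp_apply] at hq
  have hN0 : (0 : ℝ) < N := by positivity
  have hqle : (⌊α * (N : ℝ)⌋₊ : ℝ) ≤ α * N := Nat.floor_le (by positivity)
  have hqlt : α * (N : ℝ) < ⌊α * (N : ℝ)⌋₊ + 1 := Nat.lt_floor_add_one _
  have hmean := abs_mean_sub_le hα hq (by omega) hqle hqlt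
  generalize ⌊α * (N : ℝ)⌋₊ = q at *
  have hN_root : (N : ℝ) ^ (-(1 / 2 : ℝ) + ξ) * N = (N : ℝ) ^ (1 / 2 + ξ) := by
    rw [← Real.rpow_add_one hN0.ne']
    ring_nf
  refine le_trans ?_ (one_sub_le_card_filter_div (k := ⌊(1 + ε) * Real.logb (1 + α) N⌋₊ + 1)
    (t := (N : ℝ) ^ (1 / 2 + ξ) / 2) hq hN (by positivity) ?_)
  · have h1 : q / ((N : ℝ) ^ (1 / 2 + ξ) / 2) ^ 2 ≤ 4 * α * (N : ℝ) ^ (-(2 * ξ)) := by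
      have h3 : ((N : ℝ) ^ (1 / 2 + ξ)) ^ 2 = N * (N : ℝ) ^ (2 * ξ) := by
        rw [← Real.rpow_mul_natCast hN0.le, ← Real.rpow_one_add' hN0.le (by linarith)]
        congr 1
        push_cast
        ring
      have h4 : 0 < (N : ℝ) ^ (2 * ξ) := by positivity
      rw [div_pow, h3, Real.rpow_neg hN0.le, div_le_iff₀ (by positivity)]
      field_simp
      linarith
    have h2 : q * nonzeroProb q N ^ (⌊(1 + ε) * Real.logb (1 + α) N⌋₊ + 1) ≤
        α * (N : ℝ) ^ (-(ε / 2)) := by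
      refine (mul_le_mul hqle hpow (pow_nonneg (nonzeroProb_pos hq (by omega)).le _)
        (by positivity)).trans (le_of_eq ?_)
      rw [mul_assoc, ← Real.rpow_one_add' hN0.le (by linarith)]
      ring_nf
    linarith
  · intro x hx hmax
    constructor
    · rw [← mul_le_mul_iff_of_pos_right hN0, hN_root, ← abs_of_pos hN0, ← abs_mul,
        abs_of_pos hN0, sub_mul, div_mul_cancel₀ _ hN0.ne', mul_comm (α / _)]
      have h := abs_sub_le (suppCard x : ℝ) (q * nonzeroProb q N) (N * (α / (1 + α)))
      linarith
    · intro i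
      have hL : 0 ≤ (1 + ε) * Real.logb (1 + α) N :=
        mul_nonneg (by linarith) (Real.logb_nonneg (by linarith) (by exact_mod_cast (by omega)))
      exact (Nat.le_floor_iff hL).1 (Nat.lt_succ_iff.1 (hmax i))
end
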